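/- Let H = ([k], E(H)) be a fixed k-vertex undirected graph, let {r_i}_{i∈[k]}, {d_{ij}}_{{i,j}∈E(H)} be admissible parameters for H, and let S be a loading schedule for H. Let f_H : {0,1}^{C(n,2)} → {0,1} be the function with f_H(G) = 1 iff the n-vertex undirected graph G contains H as a subgraph (there is an injection i ↦ a_i from [k] to [n] with {a_i,a_j} ∈ E(G) for every {i,j} ∈ E(H)). Then the learning graph complexity of f_H is at most a constant (depending only on H) times the maximum of the following quantities: (Setup) Σ_{{u,v}∈E(H)} min{r_u,r_v}·d_{uv}; (Loading vertex s_t = i) [Π_{u∈VS_t} √(n/r_u) · Π_{{u,v}∈ES_t} √(max{r_u,r_v}/d_{uv})] · √n · ( Σ_{j : {i,j}∈E(H), r_i ≤ r_j} d_{ij} + Σ_{j : {i,j}∈E(H), r_i > r_j} r_j d_{ij}/r_i ); (Loading edge s_t = {i,j} in the dense case (2·min{r_i,r_j}+1)·d_{ij} ≥ 2·max{r_i,r_j}+1) [Π_{u∈VS_t} √(n/r_u) · Π_{{u,v}∈ES_t} √(max{r_u,r_v}/d_{uv})] · max{r_i,r_j}; (Loading edge s_t = {i,j} in the sparse case (2·min{r_i,r_j}+1)·d_{ij}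 < 2·max{r_i,r_j}+1) [Π_{u∈VS_t} √(n/r_u) · Π_{{u,v}∈ES_t} √(max{r_u,r_v}/d_{uv})] · √(r_i·r_j). (By Belovs' theorem Q(f) = O(LG(f)), the quantum query complexity of f_H obeys the same bound.) -/

import Mathlib

open scoped Classical

/-- A learning graph for a (Prop-valued, i.e. `{0,1}`-valued) function
`f : (I → q) → Prop` on inputs indexed by `I`: a rooted weighted DAG with
positive edge weights, a labeling of vertices by index sets that is empty at
the root and monotone along edges (the length of an edge `(u,v)` being
`|S(v) ∖ S(u)|`), and for every positive input `y` a unit flow from the root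
terminating only in vertices whose label contains the index set of a
1-certificate for `y`. -/
structure LearningGraphFor {I q : Type} (f : (I → q) → Prop) (V : Type) where
  root : V
  Edges : Finset (V × V)
  w : V × V → ℝ
  lab : V → Finset I
  p : {y : I → q // f y} → V × V → ℝ
  w_pos : ∀ e ∈ Edges, 0 < w e
  lab_root : lab root = ∅
  lab_mono : ∀ e ∈ Edges, lab e.1 ⊆ lab e.2
  p_nonneg : ∀ y e, 0 ≤ p y e
  p_supp : ∀ y e, e ∉ Edges → p y e = 0
  unit_flow : ∀ y,
    (∑ e ∈ Edges.filter (fun e => e.1 = root), p y e)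
      - (∑ e ∈ Edges.filter (fun e => e.2 = root), p y e) = 1
  flow_cons : ∀ y v, v ≠ root →
    (∑ e ∈ Edges.filter (fun e => e.1 = v), p y e)
      ≤ (∑ e ∈ Edges.filter (fun e => e.2 = v), p y e)
  sink_cert : ∀ (y : {y : I → q // f y}) (v : V),
    (∑ e ∈ Edges.filter (fun e => e.1 = v), p y e)
      < (∑ e ∈ Edges.filter (fun e => e.2 = v), p y e) →
    ∃ C : Finset I, C ⊆ lab v ∧ ∀ z : I → q, (∀ i ∈ C, z i = y.1 i) → f z

namespace LearningGraphFor

variable {I q V : Type} {f : (I → q) → Prop}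

/-- The negative complexity `C₀ = Σ_e ℓ(e)·w(e)`, with `ℓ((u,v)) = |S(v) ∖ S(u)|`. -/
noncomputable def C0 (G : LearningGraphFor f V) : ℝ :=
  ∑ e ∈ G.Edges, ((G.lab e.2 \ G.lab e.1).card : ℝ) * G.w e

/-- The positive complexity `C₁ = max_y Σ_e (ℓ(e)/w(e))·p_y(e)²`. -/
noncomputable def C1 (G : LearningGraphFor f V) : ℝ :=
  ⨆ y : {y : I → q // f y},
    ∑ e ∈ G.Edges, (((G.lab e.2 \ G.lab e.1).card : ℝ) / G.w e) * (G.p y e) ^ 2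

/-- The complexity `√(C₀·C₁)` of a learning graph. -/
noncomputable def complexity (G : LearningGraphFor f V) : ℝ :=
  Real.sqrt (G.C0 * G.C1)

end LearningGraphFor

/-- Admissibility of set-size parameters `r` and (symmetric) degree parameters
`d` for a `k`-vertex graph `H` on `n`-vertex inputs: `1 ≤ r i ≤ n/4`;
`1 ≤ d i j ≤ max (r i) (r j)` on edges; and every vertex `i` has an edge
`{i,j}` with `d i j·(2 r j + 1)/(2 r i + 1) ≥ 1`. -/
def Admissible (n k : ℕ) (H : SimpleGraph (Fin k)) (r : Fin k → ℕ)
    (d : Fin k → Fin k → ℕ) : Prop :=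
  (∀ i j : Fin k, d i j = d j i) ∧
  (∀ i : Fin k, 1 ≤ r i ∧ 4 * r i ≤ n) ∧
  (∀ i j : Fin k, H.Adj i j → 1 ≤ d i j ∧ d i j ≤ max (r i) (r j)) ∧
  (∀ i : Fin k, ∃ j : Fin k, H.Adj i j ∧ 2 * r i + 1 ≤ d i j * (2 * r j + 1))

/-- A loading schedule for a `k`-vertex graph `H` with `m` edges: a sequence
`s₁ … s_{k+m}` of (distinct) vertex labels and edge labels (each edge of `H`
appearing, in exactly one orientation) such that an edge appears only after
both its endpoints. -/
def IsSchedule (k : ℕ) (H : SimpleGraph (Fin k)) [DecidableRel H.Adj]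
    (s : List (Fin k ⊕ Fin k × Fin k)) : Prop :=
  s.length = k + H.edgeFinset.card ∧
  s.Nodup ∧
  (∀ i j : Fin k, Sum.inr (i, j) ∈ s → H.Adj i j) ∧
  (∀ i j : Fin k, H.Adj i j → Sum.inr (i, j) ∈ s ∨ Sum.inr (j, i) ∈ s) ∧
  (∀ i j : Fin k, ¬(Sum.inr (i, j) ∈ s ∧ Sum.inr (j, i) ∈ s)) ∧
  (∀ (t : ℕ) (i j : Fin k), s[t]? = some (Sum.inr (i, j)) →
    Sum.inl i ∈ s.take t ∧ Sum.inl j ∈ s.take t)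

/-- The factor contributed to the cost prefactor by a loaded vertex
(`√(n/r_u)`) or loaded edge (`√(max{r_u,r_v}/d_{uv})`). -/
noncomputable def entryFactor (n k : ℕ) (r : Fin k → ℕ) (d : Fin k → Fin k → ℕ) :
    Fin k ⊕ Fin k × Fin k → ℝ
  | Sum.inl u => Real.sqrt ((n : ℝ) / r u)
  | Sum.inr (u, v) => Real.sqrt ((max (r u) (r v) : ℝ) / d u v)

/-- The prefactor
`Π_{u ∈ VS_t} √(n/r_u) · Π_{{u,v} ∈ ES_t} √(max{r_u,r_v}/d_{uv})`
of stage `t` of a loading schedule `s`. -/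
noncomputable def prefactor (n k : ℕ) (r : Fin k → ℕ) (d : Fin k → Fin k → ℕ)
    (s : List (Fin k ⊕ Fin k × Fin k)) (t : ℕ) : ℝ :=
  ((s.take t).map (entryFactor n k r d)).prod

/-- The setup cost `Σ_{{u,v} ∈ E(H)} min{r_u, r_v}·d_{uv}` (each unordered
edge counted once, via a sum over ordered pairs divided by two). -/
noncomputable def setupCost (k : ℕ) (H : SimpleGraph (Fin k)) [DecidableRel H.Adj]
    (r : Fin k → ℕ) (d : Fin k → Fin k → ℕ) : ℝ :=
  (∑ p ∈ Finset.univ.filter (fun p : Fin k × Fin k => H.Adj p.1 p.2),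
      (min (r p.1) (r p.2) : ℝ) * d p.1 p.2) / 2

/-- The cost of stage `t` of a loading schedule `s`: for loading a vertex `i`,
the prefactor times `√n·(Σ_{j : {i,j} ∈ E(H), r_i ≤ r_j} d_{ij} +
Σ_{j : {i,j} ∈ E(H), r_i > r_j} r_j d_{ij}/r_i)`; for loading an edge `{i,j}`,
the prefactor times `max{r_i,r_j}` in the dense case
`(2 min{r_i,r_j}+1)·d_{ij} ≥ 2 max{r_i,r_j}+1` and times `√(r_i r_j)` in the
sparse case. -/
noncomputable def stageCost (n k : ℕ) (H : SimpleGraph (Fin k)) [DecidableRel H.Adj]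
    (r : Fin k → ℕ) (d : Fin k → Fin k → ℕ)
    (s : List (Fin k ⊕ Fin k × Fin k)) (t : ℕ) : ℝ :=
  match s[t]? with
  | some (Sum.inl i) =>
      prefactor n k r d s t * Real.sqrt (n : ℝ) *
        ((∑ j ∈ Finset.univ.filter (fun j : Fin k => H.Adj i j ∧ r i ≤ r j), (d i j : ℝ)) +
         (∑ j ∈ Finset.univ.filter (fun j : Fin k => H.Adj i j ∧ r j < r i),
            (r j : ℝ) * d i j / r i))
  | some (Sum.inr (i, j)) =>
      if 2 * max (r i) (r j) + 1 ≤ (2 * min (r i) (r j) + 1) * d i j then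
        prefactor n k r d s t * (max (r i) (r j) : ℝ)
      else
        prefactor n k r d s t * Real.sqrt ((r i : ℝ) * r j)
  | none => 0

/-- The subgraph-containment function `f_H` on (undirected, loopless)
`n`-vertex graphs, with inputs indexed by the `C(n,2)` unordered pairs of
distinct vertices: `f_H(G) = 1` iff there is an injection `i ↦ a_i` of the
vertices of `H` into `[n]` with `{a_i, a_j} ∈ E(G)` for every `{i,j} ∈ E(H)`. -/
def ContainsSubgraph (n k : ℕ) (H : SimpleGraph (Fin k))
    (x : {e : Sym2 (Fin n) // ¬ e.IsDiag} → Bool) : Prop :=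
  ∃ a : Fin k ↪ Fin n, ∀ i j : Fin k, H.Adj i j →
    ∀ e : {e : Sym2 (Fin n) // ¬ e.IsDiag}, e.1 = s(a i, a j) → x e = true

section BernoulliWeight

variable {T : Type} [DecidableEq T]

/-- The probability that the random subset of `S` containing each `a ∈ S` independently with
probability `π a` equals `X`. -/
noncomputable def bernoulliWeight (π : T → ℝ) (S X : Finset T) : ℝ :=
  (∏ a ∈ X, π a) * ∏ a ∈ S \ X, (1 - π a)

theorem bernoulliWeight_pos {π : T → ℝ} (h0 : ∀ a, 0 < π a) (h1 : ∀ a, π a < 1)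
    (S X : Finset T) : 0 < bernoulliWeight π S X :=
  mul_pos (Finset.prod_pos fun a _ => h0 a) (Finset.prod_pos fun a _ => sub_pos.2 (h1 a))

theorem sum_bernoulliWeight (π : T → ℝ) (S : Finset T) :
    ∑ X ∈ S.powerset, bernoulliWeight π S X = 1 := by
  have h := Finset.prod_add π (fun a => 1 - π a) S
  simp only [add_sub_cancel, Finset.prod_const_one] at h
  exact h.symm

/-- The Bernoulli random subset of `S` contains `A` with probability at most `∏ a ∈ A, π a`. -/
theorem sum_bernoulliWeight_subset_le {π : T → ℝ} (h0 : ∀ a, 0 < π a) (S A : Finset T) :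
    ∑ X ∈ S.powerset, (if A ⊆ X then bernoulliWeight π S X else 0) ≤ ∏ a ∈ A, π a := by
  by_cases hA : A ⊆ S
  · have h := Finset.prod_add π (fun a => if a ∈ A then 0 else 1 - π a) S
    have hl : ∏ a ∈ S, (π a + if a ∈ A then 0 else 1 - π a) = ∏ a ∈ A, π a := by
      rw [← Finset.prod_subset hA (f := fun a => π a + if a ∈ A then 0 else 1 - π a)]
      · exact Finset.prod_congr rfl fun a ha => by simp [ha]
      · intro a _ ha
        simp [ha]
    rw [← hl, h]
    refine Finset.sum_le_sum fun X _ => le_of_eq ?_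
    split_ifs with hX
    · rw [bernoulliWeight]
      congr 1
      refine Finset.prod_congr rfl fun a ha => ?_
      rw [if_neg fun h' => (Finset.mem_sdiff.1 ha).2 (hX h')]
    · obtain ⟨a, haA, haX⟩ := Finset.not_subset.1 hX
      rw [Finset.prod_eq_zero (Finset.mem_sdiff.2 ⟨hA haA, haX⟩) (by simp [haA]), mul_zero]
  · rw [Finset.sum_eq_zero]
    · exact Finset.prod_nonneg fun a _ => (h0 a).le
    · intro X hX
      rw [if_neg fun h => hA (h.trans (Finset.mem_powerset.1 hX))]

theorem sum_bernoulliWeight_mul_le {Z : Type} [Fintype Z] {π : T → ℝ} (h0 : ∀ a, 0 < π a)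
    (h1 : ∀ a, π a < 1) (S : Finset T) (p : Z → Prop) (A : Z → Finset T) {c : Finset T → ℝ}
    (hc : ∀ X ⊆ S, c X ≤ ∑ z, if p z ∧ A z ⊆ X then 1 else 0) :
    ∑ X ∈ S.powerset, bernoulliWeight π S X * c X ≤
      ∑ z, if p z then ∏ a ∈ A z, π a else 0 := by
  calc ∑ X ∈ S.powerset, bernoulliWeight π S X * c X
      ≤ ∑ X ∈ S.powerset, bernoulliWeight π S X * ∑ z, if p z ∧ A z ⊆ X then 1 else 0 :=
        Finset.sum_le_sum fun X hX => mul_le_mul_of_nonneg_left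
          (hc X (Finset.mem_powerset.1 hX)) (bernoulliWeight_pos h0 h1 S X).le
    _ = ∑ z, if p z then ∑ X ∈ S.powerset, (if A z ⊆ X then bernoulliWeight π S X else 0)
          else 0 := by
        simp only [Finset.mul_sum]
        rw [Finset.sum_comm]
        refine Finset.sum_congr rfl fun z _ => ?_
        by_cases hp : p z <;> simp [hp]
    _ ≤ _ := Finset.sum_le_sum fun z _ => by
        split_ifs
        exacts [sum_bernoulliWeight_subset_le h0 S (A z), le_rfl]

theorem bernoulliWeight_union (π : T → ℝ) {S S' X X' : Finset T} (hS : Disjoint S S')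
    (hX : X ⊆ S) (hX' : X' ⊆ S') :
    bernoulliWeight π (S ∪ S') (X ∪ X') = bernoulliWeight π S X * bernoulliWeight π S' X' := by
  have hXX : Disjoint X X' := Finset.disjoint_of_subset_left hX
    (Finset.disjoint_of_subset_right hX' hS)
  have h : (S ∪ S') \ (X ∪ X') = (S \ X) ∪ (S' \ X') := by
    ext a
    have h1 := @hX a
    have h2 := @hX' a
    have h3 : a ∈ S → a ∉ S' := fun h => Finset.disjoint_left.1 hS h
    simp only [Finset.mem_sdiff, Finset.mem_union]
    tauto
  rw [bernoulliWeight, h, Finset.prod_union hXX, Finset.prod_union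
    (Finset.disjoint_of_subset_left Finset.sdiff_subset
      (Finset.disjoint_of_subset_right Finset.sdiff_subset hS)), bernoulliWeight, bernoulliWeight]
  ring

end BernoulliWeight

section PathFlow

variable {V Θ : Type}

/-- The flow sending, for each `θ ∈ Ω`, an amount `ρ θ` along the first `N` steps of `path θ`. -/
noncomputable def pathFlow (Ω : Finset Θ) (ρ : Θ → ℝ) (path : Θ → ℕ → V) (N : ℕ)
    (e : V × V) : ℝ :=
  ∑ θ ∈ Ω, ∑ t ∈ Finset.range N, if e = (path θ t, path θ (t + 1)) then ρ θ else 0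

variable {Ω : Finset Θ} {ρ : Θ → ℝ} {path : Θ → ℕ → V} {N : ℕ} {E : Finset (V × V)}

theorem sum_mul_pathFlow (hE : ∀ θ ∈ Ω, ∀ t < N, (path θ t, path θ (t + 1)) ∈ E)
    (g : V × V → ℝ) :
    ∑ e ∈ E, g e * pathFlow Ω ρ path N e =
      ∑ θ ∈ Ω, ∑ t ∈ Finset.range N, g (path θ t, path θ (t + 1)) * ρ θ := by
  simp only [pathFlow, Finset.mul_sum]
  rw [Finset.sum_comm]
  refine Finset.sum_congr rfl fun θ hθ => ?_
  rw [Finset.sum_comm]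
  refine Finset.sum_congr rfl fun t ht => ?_
  simp only [mul_ite, mul_zero]
  rw [Finset.sum_ite_eq' E, if_pos (hE θ hθ t (Finset.mem_range.1 ht))]

theorem pathFlow_outflow_sub_inflow
    (hE : ∀ θ ∈ Ω, ∀ t < N, (path θ t, path θ (t + 1)) ∈ E) (v : V) :
    (∑ e ∈ E.filter (fun e => e.1 = v), pathFlow Ω ρ path N e)
      - (∑ e ∈ E.filter (fun e => e.2 = v), pathFlow Ω ρ path N e) =
    ∑ θ ∈ Ω, ((if path θ 0 = v then ρ θ else 0) - if path θ N = v then ρ θ else 0) := by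
  have h1 := sum_mul_pathFlow (ρ := ρ) hE (fun e => if e.1 = v then 1 else 0)
  have h2 := sum_mul_pathFlow (ρ := ρ) hE (fun e => if e.2 = v then 1 else 0)
  simp only [ite_mul, one_mul, zero_mul] at h1 h2
  rw [Finset.sum_filter, Finset.sum_filter, h1, h2, ← Finset.sum_sub_distrib]
  refine Finset.sum_congr rfl fun θ _ => ?_
  rw [← Finset.sum_sub_distrib]
  exact Finset.sum_range_sub' (fun t => if path θ t = v then ρ θ else 0) N

theorem pathFlow_nonneg (hρ : ∀ θ, 0 ≤ ρ θ) (e : V × V) : 0 ≤ pathFlow Ω ρ path N e :=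
  Finset.sum_nonneg fun θ _ => Finset.sum_nonneg fun t _ => by
    split_ifs
    exacts [hρ θ, le_rfl]

theorem pathFlow_eq_zero (hE : ∀ θ ∈ Ω, ∀ t < N, (path θ t, path θ (t + 1)) ∈ E)
    {e : V × V} (he : e ∉ E) : pathFlow Ω ρ path N e = 0 :=
  Finset.sum_eq_zero fun θ hθ => Finset.sum_eq_zero fun t ht => by
    rw [if_neg]
    rintro rfl
    exact he (hE θ hθ t (Finset.mem_range.1 ht))

/-- If no edge is used twice, the flow through each used edge is the amount of its unique path. -/
theorem sum_mul_pathFlow_sq (hE : ∀ θ ∈ Ω, ∀ t < N, (path θ t, path θ (t + 1)) ∈ E)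
    (hinj : ∀ θ ∈ Ω, ∀ θ' ∈ Ω, ∀ t t', (path θ t, path θ (t + 1)) = (path θ' t', path θ' (t' + 1)) →
      θ = θ' ∧ t = t')
    (g : V × V → ℝ) :
    ∑ e ∈ E, g e * pathFlow Ω ρ path N e ^ 2 =
      ∑ θ ∈ Ω, ∑ t ∈ Finset.range N, g (path θ t, path θ (t + 1)) * ρ θ ^ 2 := by
  have h := sum_mul_pathFlow (ρ := ρ) hE (fun e => g e * pathFlow Ω ρ path N e)
  simp only [mul_assoc, ← sq] at h
  rw [h]
  refine Finset.sum_congr rfl fun θ hθ => Finset.sum_congr rfl fun t ht => ?_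
  have hp : pathFlow Ω ρ path N (path θ t, path θ (t + 1)) = ρ θ := by
    rw [pathFlow, Finset.sum_eq_single_of_mem θ hθ, Finset.sum_eq_single_of_mem t ht, if_pos rfl]
    · intro t' _ ht'
      exact if_neg fun h => ht' (hinj θ hθ θ hθ t t' h).2.symm
    · intro θ' hθ' hne
      exact Finset.sum_eq_zero fun t' _ => if_neg fun h => hne (hinj θ hθ θ' hθ' t t' h).1.symm
  rw [hp, sq]

/-- The learning graph whose flow for each positive input is a probability distribution over
paths from the root to vertices labeled by certificates. -/
noncomputable def LearningGraphFor.ofPaths {I q : Type} {f : (I → q) → Prop}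
    (root : V) (E : Finset (V × V)) (w : V × V → ℝ) (lab : V → Finset I)
    (Ω : {y : I → q // f y} → Finset Θ) (ρ : {y : I → q // f y} → Θ → ℝ)
    (path : {y : I → q // f y} → Θ → ℕ → V) (N : ℕ)
    (w_pos : ∀ e ∈ E, 0 < w e) (lab_root : lab root = ∅)
    (lab_mono : ∀ e ∈ E, lab e.1 ⊆ lab e.2)
    (hρ : ∀ y θ, 0 ≤ ρ y θ) (hsum : ∀ y, ∑ θ ∈ Ω y, ρ y θ = 1)
    (hE : ∀ y, ∀ θ ∈ Ω y, ∀ t < N, (path y θ t, path y θ (t + 1)) ∈ E)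
    (h0 : ∀ y θ, path y θ 0 = root) (hN : ∀ y θ, path y θ N ≠ root)
    (hcert : ∀ y, ∀ θ ∈ Ω y, ∃ C : Finset I, C ⊆ lab (path y θ N) ∧
      ∀ z : I → q, (∀ i ∈ C, z i = y.1 i) → f z) :
    LearningGraphFor f V where
  root := root
  Edges := E
  w := w
  lab := lab
  p y := pathFlow (Ω y) (ρ y) (path y) N
  w_pos := w_pos
  lab_root := lab_root
  lab_mono := lab_mono
  p_nonneg y := pathFlow_nonneg (hρ y)
  p_supp y _ he := pathFlow_eq_zero (hE y) he
  unit_flow y := by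
    rw [pathFlow_outflow_sub_inflow (hE y), ← hsum y]
    exact Finset.sum_congr rfl fun θ _ => by rw [if_pos (h0 y θ), if_neg (hN y θ), sub_zero]
  flow_cons y v hv := by
    rw [← sub_nonpos, pathFlow_outflow_sub_inflow (hE y)]
    refine Finset.sum_nonpos fun θ _ => ?_
    rw [if_neg fun h => hv (h.symm.trans (h0 y θ)), zero_sub, neg_nonpos]
    split_ifs
    exacts [hρ y θ, le_rfl]
  sink_cert y v hv := by
    rw [← sub_neg, pathFlow_outflow_sub_inflow (hE y)] at hv
    obtain ⟨θ, hθ, h⟩ := Finset.exists_lt_of_sum_lt (g := fun _ => (0 : ℝ))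
      (hv.trans_eq Finset.sum_const_zero.symm)
    have hθv : path y θ N = v := by
      by_contra hne
      rw [if_neg hne, sub_zero] at h
      split_ifs at h
      exacts [absurd h (hρ y θ).not_gt, lt_irrefl _ h]
    exact hθv ▸ hcert y θ hθ

end PathFlow

section Schedule

variable {T Entry : Type} [DecidableEq T]

/-- The elements placed by the first `t` entries of the schedule `s`. -/
def placed (σ : Entry → T) (s : List Entry) (t : ℕ) : Finset T :=
  ((s.take t).map σ).toFinset

theorem mem_placed {σ : Entry → T} {s : List Entry} {t : ℕ} {a : T} :
    a ∈ placed σ s t ↔ ∃ e ∈ s.take t, σ e = a := by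
  simp only [placed, List.mem_toFinset, List.mem_map]

theorem placed_zero (σ : Entry → T) (s : List Entry) : placed σ s 0 = ∅ := by
  simp [placed]

theorem placed_succ (σ : Entry → T) (s : List Entry) {t : ℕ} (ht : t < s.length) :
    placed σ s (t + 1) = insert (σ s[t]) (placed σ s t) := by
  ext a
  simp only [mem_placed, List.take_add_one, List.getElem?_eq_getElem ht, Option.toList_some,
    List.mem_append, List.mem_singleton, or_and_right, exists_or, exists_eq_left,
    Finset.mem_insert]
  rw [or_comm, eq_comm]

theorem placed_subset (σ : Entry → T) (s : List Entry) (t : ℕ) :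
    placed σ s t ⊆ placed σ s s.length := by
  intro a ha
  obtain ⟨e, he, rfl⟩ := mem_placed.1 ha
  exact mem_placed.2 ⟨e, by simpa using List.mem_of_mem_take he, rfl⟩

theorem half_pow_mul_le_bernoulliWeight_placed {s : List Entry} (hs : s.Nodup)
    {kind : T → Entry} {π : Entry → ℝ} (h0 : ∀ e, 0 < π e) (h1 : ∀ e, π e ≤ 1 / 2)
    {σ : Entry → T} (hσ : ∀ e, kind (σ e) = e) (t : ℕ) :
    (1 / 2) ^ s.length * ((s.take t).map π).prod ≤
      bernoulliWeight (π ∘ kind) (placed σ s s.length) (placed σ s t) := by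
  have hinj : Function.Injective σ := Function.LeftInverse.injective hσ
  have hprod : ∏ a ∈ placed σ s t, (π ∘ kind) a = ((s.take t).map π).prod := by
    rw [placed, List.prod_toFinset _ ((hs.sublist (List.take_sublist t s)).map hinj), List.map_map]
    congr 2
    funext e
    simp [hσ]
  rw [bernoulliWeight, hprod, mul_comm]
  refine mul_le_mul_of_nonneg_left ?_ (List.prod_nonneg ?_)
  · have hcard : (placed σ s s.length \ placed σ s t).card ≤ s.length :=
      (Finset.card_le_card Finset.sdiff_subset).trans
        ((List.toFinset_card_le _).trans (by simp))
    calc (1 / 2 : ℝ) ^ s.length ≤ (1 / 2) ^ (placed σ s s.length \ placed σ s t).card :=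
          pow_le_pow_of_le_one (by norm_num) (by norm_num) hcard
      _ = ∏ _a ∈ placed σ s s.length \ placed σ s t, (1 / 2 : ℝ) := by simp
      _ ≤ _ := Finset.prod_le_prod (fun _ _ => by norm_num) fun a _ => by
          have := h1 (kind a)
          simp only [Function.comp_apply]
          linarith
  · intro x hx
    obtain ⟨e, _, rfl⟩ := List.mem_map.1 hx
    exact (h0 e).le

end Schedule

section ScheduledGraph

variable {T Entry : Type}

/-- The edge weight proportional to the probability of the source (of the target, for edges
leaving the root), scaled by `β t` at level `t`. -/
noncomputable def scheduleWeight (μ : Finset T → ℝ) (β : ℕ → ℝ) :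
    Option (ℕ × Finset T) × Option (ℕ × Finset T) → ℝ
  | (none, none) => 1
  | (none, some (_, X)) => μ X
  | (some (t, X), _) => β t * μ X

theorem scheduleWeight_pos {μ : Finset T → ℝ} {β : ℕ → ℝ} (hμ : ∀ X, 0 < μ X)
    (hβ : ∀ t, 0 < β t) : ∀ e, 0 < scheduleWeight μ β e
  | (none, none) => one_pos
  | (none, some (_, X)) => hμ X
  | (some (t, X), _) => mul_pos (hβ t) (hμ X)

variable [DecidableEq T]

/-- The path which starts with the random set `Y` and then inserts the elements placed by the
schedule one at a time. -/
def schedulePath (σ : Entry → T) (s : List Entry) (Y : Finset T) : ℕ → Option (ℕ × Finset T)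
  | 0 => none
  | t + 1 => some (t, Y ∪ placed σ s t)

/-- The edges from the root to every set, and from level `t` to level `t + 1` by insertion of an
element whose kind is the `t`-th entry of the schedule. -/
noncomputable def scheduleEdges [Fintype T] (s : List Entry) (kind : T → Entry) :
    Finset (Option (ℕ × Finset T) × Option (ℕ × Finset T)) :=
  Finset.univ.image (fun X : Finset T => (none, some (0, X))) ∪
    ((Finset.range s.length ×ˢ (Finset.univ : Finset (Finset T × T))).filter
      (fun z => s[z.1]? = some (kind z.2.2))).image
        fun z => (some (z.1, z.2.1), some (z.1 + 1, insert z.2.2 z.2.1))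

theorem schedulePath_edge_mem [Fintype T] {s : List Entry} {kind : T → Entry} {σ : Entry → T}
    (hσ : ∀ e, kind (σ e) = e) (Y : Finset T) :
    ∀ t < s.length + 1,
      (schedulePath σ s Y t, schedulePath σ s Y (t + 1)) ∈ scheduleEdges s kind
  | 0, _ => Finset.mem_union_left _ (Finset.mem_image.2 ⟨Y ∪ placed σ s 0, Finset.mem_univ _, rfl⟩)
  | t + 1, ht => by
    have ht' : t < s.length := Nat.lt_of_succ_lt_succ ht
    refine Finset.mem_union_right _ (Finset.mem_image.2 ⟨(t, Y ∪ placed σ s t, σ s[t]), ?_, ?_⟩)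
    · simp [hσ, ht']
    · simp [schedulePath, placed_succ σ s ht', Finset.union_insert]

theorem schedulePath_edge_injective {σ : Entry → T} {s : List Entry} {Y Y' : Finset T}
    (hY : Disjoint Y (placed σ s s.length)) (hY' : Disjoint Y' (placed σ s s.length)) {t t' : ℕ}
    (h : (schedulePath σ s Y t, schedulePath σ s Y (t + 1)) =
      (schedulePath σ s Y' t', schedulePath σ s Y' (t' + 1))) : Y = Y' ∧ t = t' := by
  simp only [schedulePath, Prod.mk.injEq, Option.some.injEq] at h
  obtain ⟨-, rfl, h⟩ := h
  refine ⟨?_, rfl⟩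
  have hs := placed_subset σ s t
  calc Y = (Y ∪ placed σ s t) \ placed σ s t := by
        rw [Finset.union_sdiff_cancel_right (Finset.disjoint_of_subset_right hs hY)]
    _ = Y' := by
        rw [h, Finset.union_sdiff_cancel_right (Finset.disjoint_of_subset_right hs hY')]

theorem sum_scheduleEdges_le [Fintype T] (s : List Entry) (kind : T → Entry)
    (F : Option (ℕ × Finset T) × Option (ℕ × Finset T) → ℝ) (hF : ∀ e, 0 ≤ F e) :
    ∑ e ∈ scheduleEdges s kind, F e ≤ ∑ X : Finset T, F (none, some (0, X)) +
      ∑ t ∈ Finset.range s.length, ∑ X : Finset T,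
        ∑ a ∈ Finset.univ.filter (fun a => s[t]? = some (kind a)),
          F (some (t, X), some (t + 1, insert a X)) := by
  rw [scheduleEdges]
  refine (le_add_of_nonneg_right (Finset.sum_nonneg fun e _ => hF e)).trans
    ((Finset.sum_union_inter).le.trans (add_le_add ?_ ?_))
  · exact Finset.sum_image_le_of_nonneg fun e _ => hF e
  · refine (Finset.sum_image_le_of_nonneg fun e _ => hF e).trans (le_of_eq ?_)
    rw [Finset.sum_filter, Finset.sum_product]
    refine Finset.sum_congr rfl fun t _ => ?_
    rw [← Finset.univ_product_univ, Finset.sum_product]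
    simp only [Finset.sum_filter]

end ScheduledGraph

/-- Given a schedule `s` of elements to be inserted into a Bernoulli random set, the learning
graph inserting them one after the other has complexity bounded by the expected setup length `D`
and, at each stage, the total expected length `U t` over all insertions of the scheduled kind
and the expected length `W t` of the insertion used by the flow. -/
theorem exists_learningGraph_complexity_le {I q T Entry : Type} [Fintype T] [DecidableEq T]
    [instI : DecidableEq I] {f : (I → q) → Prop} {s : List Entry} (hs : s.Nodup)
    {kind : T → Entry} {π : Entry → ℝ} (h0 : ∀ e, 0 < π e) (h1 : ∀ e, π e ≤ 1 / 2)
    {lab : Finset T → Finset I} (hlab : Monotone lab)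
    {σ : {y : I → q // f y} → Entry → T} (hσ : ∀ y e, kind (σ y e) = e)
    (hcert : ∀ y X, (∀ e ∈ s, σ y e ∈ X) → ∃ C : Finset I, C ⊆ lab X ∧
      ∀ z : I → q, (∀ i ∈ C, z i = y.1 i) → f z)
    {D : ℝ} (hD : ∀ S, ∑ X ∈ S.powerset, bernoulliWeight (π ∘ kind) S X * (lab X).card ≤ D)
    {U W : ℕ → ℝ} (hU0 : ∀ t, 0 < U t) (hW0 : ∀ t, 0 < W t)
    (hU : ∀ (t : ℕ) (ht : t < s.length), ∑ X : Finset T,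
      bernoulliWeight (π ∘ kind) Finset.univ X *
        ∑ a ∈ Finset.univ.filter (fun a => s[t] = kind a),
          ((lab (insert a X) \ lab X).card : ℝ) ≤ U t)
    (hW : ∀ (t : ℕ) (ht : t < s.length) y, ∑ X ∈ (placed (σ y) s s.length)ᶜ.powerset,
      bernoulliWeight (π ∘ kind) (placed (σ y) s s.length)ᶜ X *
        ((lab (insert (σ y s[t]) (X ∪ placed (σ y) s t)) \
          lab (X ∪ placed (σ y) s t)).card : ℝ) ≤ W t) :
    ∃ (V : Type) (G : LearningGraphFor f V), G.complexity ≤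
      2 ^ s.length * (D + ∑ t ∈ Finset.range s.length,
        √(U t * W t / ((s.take t).map π).prod)) := by
  obtain rfl : instI = fun a b => Classical.propDecidable (a = b) := Subsingleton.elim _ _
  set μ : Finset T → ℝ := bernoulliWeight (π ∘ kind) Finset.univ with hμdef
  set ρ : {y : I → q // f y} → Finset T → ℝ := fun y =>
    bernoulliWeight (π ∘ kind) (placed (σ y) s s.length)ᶜ with hρdef
  set Q : ℕ → ℝ := fun t => ((s.take t).map π).prod with hQdef
  have hlt : ∀ a, (π ∘ kind) a < 1 := fun a => (h1 _).trans_lt (by norm_num)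
  have hμ : ∀ X, 0 < μ X := bernoulliWeight_pos (fun a => h0 _) hlt _
  have hρ : ∀ y X, 0 < ρ y X := fun y => bernoulliWeight_pos (fun a => h0 _) hlt _
  have hQ : ∀ t, 0 < Q t := fun t => List.prod_pos fun x hx => by
    obtain ⟨e, _, rfl⟩ := List.mem_map.1 hx
    exact h0 e
  have hD0 : 0 ≤ D := le_trans (Finset.sum_nonneg fun X _ =>
    mul_nonneg (bernoulliWeight_pos (fun a => h0 _) hlt _ _).le (Nat.cast_nonneg _)) (hD ∅)
  set β : ℕ → ℝ := fun t => √(W t / (U t * Q t)) with hβdef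
  have hβ : ∀ t, 0 < β t := fun t => Real.sqrt_pos.2 (div_pos (hW0 t) (mul_pos (hU0 t) (hQ t)))
  have hβU : ∀ t, β t * U t = √(U t * W t / Q t) := fun t => by
    have hu := hU0 t
    have hq := hQ t
    rw [← Real.sqrt_sq hu.le, ← Real.sqrt_mul (div_pos (hW0 t) (mul_pos hu hq)).le,
      Real.sqrt_sq hu.le]
    congr 1
    field_simp
  have hβW : ∀ t, W t / (β t * Q t) = √(U t * W t / Q t) := fun t => by
    have hu := hU0 t
    have hq := hQ t
    have hw := hW0 t
    rw [div_eq_iff (mul_pos (hβ t) hq).ne', ← hβU t]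
    have hsq : β t * β t = W t / (U t * Q t) :=
      Real.mul_self_sqrt (div_pos hw (mul_pos hu hq)).le
    calc W t = W t / (U t * Q t) * (U t * Q t) := by field_simp
      _ = _ := by
        rw [← hsq]
        ring
  have hdisj : ∀ y, ∀ Y ∈ (placed (σ y) s s.length)ᶜ.powerset,
      Disjoint Y (placed (σ y) s s.length) := fun y Y hY =>
    Finset.disjoint_of_subset_left (Finset.mem_powerset.1 hY) disjoint_compl_left
  have hratio : ∀ y, ∀ Y ∈ (placed (σ y) s s.length)ᶜ.powerset, ∀ t,
      ρ y Y ^ 2 / μ (Y ∪ placed (σ y) s t) ≤ 2 ^ s.length * ρ y Y / Q t := by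
    intro y Y hY t
    have hw := half_pow_mul_le_bernoulliWeight_placed hs h0 h1 (hσ y) t
    have hμeq : μ (Y ∪ placed (σ y) s t) = ρ y Y *
        bernoulliWeight (π ∘ kind) (placed (σ y) s s.length) (placed (σ y) s t) := by
      rw [← bernoulliWeight_union _ disjoint_compl_left (Finset.mem_powerset.1 hY)
        (placed_subset _ _ _), Finset.union_comm (_ᶜ), Finset.union_compl]
    rw [hμeq, sq, mul_div_mul_left _ _ (hρ y Y).ne', mul_comm (2 ^ _ : ℝ), mul_div_assoc,
      div_eq_mul_inv]
    refine mul_le_mul_of_nonneg_left ?_ (hρ y Y).le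
    have hb : 0 < bernoulliWeight (π ∘ kind) (placed (σ y) s s.length) (placed (σ y) s t) :=
      bernoulliWeight_pos (fun a => h0 _) hlt _ _
    have hq : 0 < 2 ^ s.length / Q t := div_pos (pow_pos two_pos _) (hQ t)
    rw [inv_le_comm₀ hb hq, inv_div]
    refine le_trans (le_of_eq ?_) hw
    rw [one_div, inv_pow, inv_mul_eq_div]
  set labV : Option (ℕ × Finset T) → Finset I := fun v => v.elim ∅ fun z => lab z.2 with hlabV
  let G : LearningGraphFor f (Option (ℕ × Finset T)) := LearningGraphFor.ofPaths none
    (scheduleEdges s kind) (scheduleWeight μ β) labV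
    (fun y => (placed (σ y) s s.length)ᶜ.powerset) ρ (fun y => schedulePath (σ y) s)
    (s.length + 1) (fun e _ => scheduleWeight_pos hμ hβ e) rfl
    (by
      intro e he
      rcases Finset.mem_union.1 he with he | he
      · obtain ⟨X, _, rfl⟩ := Finset.mem_image.1 he
        exact Finset.empty_subset _
      · obtain ⟨z, _, rfl⟩ := Finset.mem_image.1 he
        exact hlab (Finset.subset_insert _ _))
    (fun y Y => (hρ y Y).le) (fun y => sum_bernoulliWeight _ _)
    (fun y Y _ => schedulePath_edge_mem (hσ y) Y) (fun _ _ => rfl)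
    (fun _ _ => Option.some_ne_none _)
    (fun y Y _ => hcert y _ fun e he => Finset.mem_union_right _
      (mem_placed.2 ⟨e, by simpa using he, rfl⟩))
  set A : ℝ := D + ∑ t ∈ Finset.range s.length, √(U t * W t / Q t) with hA
  have hA0 : 0 ≤ A := add_nonneg hD0 (Finset.sum_nonneg fun t _ => Real.sqrt_nonneg _)
  have hC0 : G.C0 ≤ A := by
    have hG : G.C0 = ∑ e ∈ scheduleEdges s kind,
        ((labV e.2 \ labV e.1).card : ℝ) * scheduleWeight μ β e := rfl
    rw [hG]
    refine (sum_scheduleEdges_le s kind _ fun e => mul_nonneg (Nat.cast_nonneg _)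
      (scheduleWeight_pos hμ hβ e).le).trans (add_le_add ?_ (Finset.sum_le_sum fun t ht => ?_))
    · refine le_trans (le_of_eq ?_) (hD Finset.univ)
      rw [Finset.powerset_univ]
      refine Finset.sum_congr rfl fun X _ => ?_
      simp [hlabV, scheduleWeight, hμdef, mul_comm]
    · have ht' := Finset.mem_range.1 ht
      rw [← hβU]
      refine le_trans (le_of_eq ?_) (mul_le_mul_of_nonneg_left (hU t ht') (hβ t).le)
      simp only [List.getElem?_eq_getElem ht', Option.some.injEq, Finset.mul_sum]
      refine Finset.sum_congr rfl fun X _ => Finset.sum_congr rfl fun a _ => ?_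
      simp only [hlabV, scheduleWeight, Option.elim]
      ring
  have hC1 : G.C1 ≤ 2 ^ s.length * A := by
    refine Real.iSup_le (fun y => ?_) (by positivity)
    have hG : ∑ e ∈ G.Edges, (((G.lab e.2 \ G.lab e.1).card : ℝ) / G.w e) * (G.p y e) ^ 2 =
        ∑ e ∈ scheduleEdges s kind, (((labV e.2 \ labV e.1).card : ℝ) / scheduleWeight μ β e) *
          pathFlow (placed (σ y) s s.length)ᶜ.powerset (ρ y) (schedulePath (σ y) s)
            (s.length + 1) e ^ 2 := rfl
    refine le_trans (le_of_eq ?_) (?_ : ∑ Y ∈ (placed (σ y) s s.length)ᶜ.powerset,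
      (((lab Y).card : ℝ) * (ρ y Y ^ 2 / μ (Y ∪ placed (σ y) s 0)) +
        ∑ t ∈ Finset.range s.length, (if ht : t < s.length then
          ((lab (insert (σ y s[t]) (Y ∪ placed (σ y) s t)) \
          lab (Y ∪ placed (σ y) s t)).card : ℝ) else 0) / β t *
            (ρ y Y ^ 2 / μ (Y ∪ placed (σ y) s t))) ≤ _)
    · refine hG.trans ?_
      rw [sum_mul_pathFlow_sq (fun Y _ => schedulePath_edge_mem (hσ y) Y)
        fun Y hY Y' hY' t t' => schedulePath_edge_injective (hdisj y Y hY) (hdisj y Y' hY')]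
      refine Finset.sum_congr rfl fun Y _ => ?_
      rw [Finset.sum_range_succ', add_comm]
      congr 1
      · simp only [schedulePath, hlabV, scheduleWeight, Option.elim, placed_zero,
          Finset.union_empty, Finset.sdiff_empty]
        ring
      · refine Finset.sum_congr rfl fun t ht => ?_
        have ht' := Finset.mem_range.1 ht
        simp only [schedulePath, hlabV, scheduleWeight, Option.elim, ht', dite_true,
          placed_succ (σ y) s ht', Finset.union_insert]
        have h1 := (hβ t).ne'
        have h2 := (hμ (Y ∪ placed (σ y) s t)).ne'
        field_simp
    · rw [Finset.sum_add_distrib, Finset.sum_comm, hA, mul_add, Finset.mul_sum]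
      refine add_le_add ?_ (Finset.sum_le_sum fun t ht => ?_)
      · refine le_trans ?_ (mul_le_mul_of_nonneg_left
          (hD (placed (σ y) s s.length)ᶜ) (by positivity))
        rw [Finset.mul_sum]
        refine Finset.sum_le_sum fun Y hY => ?_
        refine (mul_le_mul_of_nonneg_left (hratio y Y hY 0) (Nat.cast_nonneg _)).trans
          (le_of_eq ?_)
        simp only [hQdef, hρdef, List.take_zero, List.map_nil, List.prod_nil, div_one]
        ring
      · have ht' := Finset.mem_range.1 ht
        have hb := hβ t
        have hq := hQ t
        rw [← hβW]
        refine le_trans ?_ (mul_le_mul_of_nonneg_left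
          (div_le_div_of_nonneg_right (hW t ht' y) (mul_pos hb hq).le) (by positivity))
        rw [Finset.sum_div, Finset.mul_sum]
        refine Finset.sum_le_sum fun Y hY => ?_
        simp only [ht', dite_true]
        refine (mul_le_mul_of_nonneg_left (hratio y Y hY t)
          (div_nonneg (Nat.cast_nonneg _) hb.le)).trans (le_of_eq ?_)
        simp only [hρdef]
        field_simp
  have hC1' : 0 ≤ G.C1 := Real.iSup_nonneg fun y => Finset.sum_nonneg fun e he =>
    mul_nonneg (div_nonneg (Nat.cast_nonneg _) (G.w_pos e he).le) (sq_nonneg _)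
  refine ⟨_, G, ?_⟩
  rw [LearningGraphFor.complexity]
  refine Real.sqrt_le_iff.2 ⟨by positivity, ?_⟩
  calc G.C0 * G.C1 ≤ A * (2 ^ s.length * A) := mul_le_mul hC0 hC1 hC1' hA0
    _ ≤ 2 ^ s.length * (A * (2 ^ s.length * A)) :=
        le_mul_of_one_le_left (by positivity) (one_le_pow₀ one_le_two)
    _ = _ := by ring

section Subgraph

variable {n k : ℕ}

/-- A potential element of the random structure: a candidate `v ∈ [n]` for a vertex of `H`, or a
candidate pair `(u, v)` for an ordered pair of vertices of `H`. -/
abbrev Candidate (n k : ℕ) : Type := (Fin k × Fin n) ⊕ ((Fin k × Fin k) × (Fin n × Fin n))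

/-- The vertex or pair of vertices of `H` for which an element is a candidate. -/
def Candidate.kind : Candidate n k → Fin k ⊕ Fin k × Fin k := Sum.map Prod.fst Prod.fst

/-- The candidate given by an assignment of vertices of `[n]` to the vertices of `H`. -/
def Candidate.ofMap (a : Fin k → Fin n) : Fin k ⊕ Fin k × Fin k → Candidate n k :=
  Sum.map (fun i => (i, a i)) fun e => (e, (a e.1, a e.2))

theorem Candidate.kind_ofMap (a : Fin k → Fin n) (e : Fin k ⊕ Fin k × Fin k) :
    (Candidate.ofMap a e).kind = e := by
  rcases e with i | e <;> rfl

theorem sum_kind_inl (i : Fin k) (g : Candidate n k → ℝ) :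
    ∑ a ∈ Finset.univ.filter (fun a : Candidate n k => Sum.inl i = a.kind), g a =
      ∑ v, g (Sum.inl (i, v)) := by
  rw [Finset.sum_filter, Fintype.sum_sum_type]
  simp [Candidate.kind, Fintype.sum_prod_type, Finset.sum_comm (γ := Fin k)]

theorem sum_kind_inr (e : Fin k × Fin k) (g : Candidate n k → ℝ) :
    ∑ a ∈ Finset.univ.filter (fun a : Candidate n k => Sum.inr e = a.kind), g a =
      ∑ w, g (Sum.inr (e, w)) := by
  rw [Finset.sum_filter, Fintype.sum_sum_type, Fintype.sum_prod_type (α₁ := Fin k × Fin k)]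
  simp only [Candidate.kind, Sum.map_inl, Sum.map_inr, reduceCtorEq, if_false,
    Finset.sum_const_zero, zero_add, Sum.inr.injEq]
  rw [Finset.sum_comm]
  simp

/-- The candidate pairs in `X`, for pairs scheduled in `s`, both of whose ends are in `X`. -/
noncomputable def loadedPairs (s : List (Fin k ⊕ Fin k × Fin k)) (X : Finset (Candidate n k)) :
    Finset ((Fin k × Fin k) × (Fin n × Fin n)) :=
  Finset.univ.filter fun z => Sum.inr z.1 ∈ s ∧ Sum.inl (z.1.1, z.2.1) ∈ X ∧
    Sum.inl (z.1.2, z.2.2) ∈ X ∧ Sum.inr z ∈ X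

theorem mem_loadedPairs {s : List (Fin k ⊕ Fin k × Fin k)} {X : Finset (Candidate n k)}
    {z : (Fin k × Fin k) × (Fin n × Fin n)} :
    z ∈ loadedPairs s X ↔ Sum.inr z.1 ∈ s ∧ Sum.inl (z.1.1, z.2.1) ∈ X ∧
      Sum.inl (z.1.2, z.2.2) ∈ X ∧ Sum.inr z ∈ X := by
  simp [loadedPairs]

/-- The pairs of `[n]` queried by a structure. -/
noncomputable def loadedLabel (s : List (Fin k ⊕ Fin k × Fin k)) (X : Finset (Candidate n k)) :
    Finset {e : Sym2 (Fin n) // ¬ e.IsDiag} :=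
  Finset.univ.filter fun e => ∃ z ∈ loadedPairs s X, e.1 = s(z.2.1, z.2.2)

theorem mem_loadedLabel {s : List (Fin k ⊕ Fin k × Fin k)} {X : Finset (Candidate n k)}
    {e : {e : Sym2 (Fin n) // ¬ e.IsDiag}} :
    e ∈ loadedLabel s X ↔ ∃ z ∈ loadedPairs s X, e.1 = s(z.2.1, z.2.2) := by
  simp [loadedLabel]

theorem loadedPairs_mono (s : List (Fin k ⊕ Fin k × Fin k)) :
    Monotone (loadedPairs (n := n) s) := fun X X' h z hz => by
  rw [mem_loadedPairs] at hz ⊢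
  exact ⟨hz.1, h hz.2.1, h hz.2.2.1, h hz.2.2.2⟩

theorem loadedLabel_mono (s : List (Fin k ⊕ Fin k × Fin k)) :
    Monotone (loadedLabel (n := n) s) := fun X X' h e he => by
  rw [mem_loadedLabel] at he ⊢
  obtain ⟨z, hz, he⟩ := he
  exact ⟨z, loadedPairs_mono s h hz, he⟩

theorem card_loadedLabel_le (s : List (Fin k ⊕ Fin k × Fin k)) (X : Finset (Candidate n k)) :
    (loadedLabel s X).card ≤ (loadedPairs s X).card := by
  rw [← Finset.card_image_of_injective (loadedLabel s X) Subtype.val_injective]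
  refine (Finset.card_le_card fun e he => ?_).trans
    (Finset.card_image_le (f := fun z => s(z.2.1, z.2.2)))
  obtain ⟨e, hmem, rfl⟩ := Finset.mem_image.1 he
  obtain ⟨z, hz, h⟩ := mem_loadedLabel.1 hmem
  exact Finset.mem_image.2 ⟨z, hz, h.symm⟩

theorem card_loadedLabel_sdiff_le (s : List (Fin k ⊕ Fin k × Fin k))
    (X X' : Finset (Candidate n k)) :
    (loadedLabel s X' \ loadedLabel s X).card ≤ (loadedPairs s X' \ loadedPairs s X).card := by
  rw [← Finset.card_image_of_injective (loadedLabel s X' \ _) Subtype.val_injective]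
  refine (Finset.card_le_card fun e he => ?_).trans
    (Finset.card_image_le (f := fun z => s(z.2.1, z.2.2)))
  obtain ⟨e, hmem, rfl⟩ := Finset.mem_image.1 he
  obtain ⟨he', hne⟩ := Finset.mem_sdiff.1 hmem
  obtain ⟨z, hz, h⟩ := mem_loadedLabel.1 he'
  exact Finset.mem_image.2 ⟨z, Finset.mem_sdiff.2
    ⟨hz, fun hz' => hne (mem_loadedLabel.2 ⟨z, hz', h⟩)⟩, h.symm⟩

/-- The scheduled pairs joining the vertex `i` to a vertex `j`, together with a candidate `u` for
`j`; the two summands are the two orientations. -/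
def incident (s : List (Fin k ⊕ Fin k × Fin k)) (i : Fin k) :
    (Fin k × Fin n) ⊕ (Fin k × Fin n) → Prop
  | Sum.inl (j, _) => Sum.inr (i, j) ∈ s
  | Sum.inr (j, _) => Sum.inr (j, i) ∈ s

/-- The candidate pair formed by `v` for `i` and the given candidate for an incident vertex. -/
def incidentPair (i : Fin k) (v : Fin n) :
    (Fin k × Fin n) ⊕ (Fin k × Fin n) → (Fin k × Fin k) × (Fin n × Fin n)
  | Sum.inl (j, u) => ((i, j), (v, u))
  | Sum.inr (j, u) => ((j, i), (u, v))

/-- The candidates needed in order that `v`, when loaded for `i`, produces the given pair. -/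
def incidentCandidates (i : Fin k) (v : Fin n) (z : (Fin k × Fin n) ⊕ (Fin k × Fin n)) :
    Finset (Candidate n k) :=
  {Sum.inl (z.elim id id), Sum.inr (incidentPair i v z)}

theorem card_loadedPairs_insert_inl_le {s : List (Fin k ⊕ Fin k × Fin k)}
    (hs : ∀ i j : Fin k, Sum.inr (i, j) ∈ s → i ≠ j) (i : Fin k) (v : Fin n)
    (X : Finset (Candidate n k)) :
    ((loadedPairs s (insert (Sum.inl (i, v)) X) \ loadedPairs s X).card : ℝ) ≤
      ∑ z, if incident s i z ∧ incidentCandidates i v z ⊆ X then 1 else 0 := by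
  rw [Finset.sum_boole]
  refine Nat.cast_le.2 ((Finset.card_le_card fun z hz => ?_).trans
    (Finset.card_image_le (f := incidentPair i v)))
  obtain ⟨h, h'⟩ := Finset.mem_sdiff.1 hz
  rw [mem_loadedPairs] at h h'
  obtain ⟨⟨j, l⟩, u, w⟩ := z
  have hjl := hs j l h.1
  simp only [Finset.mem_insert, Sum.inl.injEq, Prod.mk.injEq, reduceCtorEq, false_or] at h h'
  obtain ⟨hmem, h1, h2, h3⟩ := h
  simp only [Finset.mem_image, Finset.mem_filter, Finset.mem_univ, true_and]
  by_cases hj : j = i ∧ u = v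
  · obtain ⟨rfl, rfl⟩ := hj
    have h2' := h2.resolve_left fun h => hjl h.1.symm
    refine ⟨Sum.inl (l, w), ⟨hmem, ?_⟩, rfl⟩
    simp [incidentCandidates, incidentPair, Finset.insert_subset_iff, h2', h3]
  · have h1' := h1.resolve_left hj
    by_cases hl : l = i ∧ w = v
    · obtain ⟨rfl, rfl⟩ := hl
      refine ⟨Sum.inr (j, u), ⟨hmem, ?_⟩, rfl⟩
      simp [incidentCandidates, incidentPair, Finset.insert_subset_iff, h1', h3]
    · exact absurd ⟨hmem, h1', h2.resolve_left hl, h3⟩ h'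

theorem loadedPairs_insert_inr_sdiff_subset (s : List (Fin k ⊕ Fin k × Fin k))
    (z : (Fin k × Fin k) × (Fin n × Fin n)) (X : Finset (Candidate n k)) :
    loadedPairs s (insert (Sum.inr z) X) \ loadedPairs s X ⊆
      if {Sum.inl (z.1.1, z.2.1), Sum.inl (z.1.2, z.2.2)} ⊆ X then {z} else ∅ := by
  intro y hy
  obtain ⟨h, h'⟩ := Finset.mem_sdiff.1 hy
  rw [mem_loadedPairs] at h h'
  simp only [Finset.mem_insert, Sum.inr.injEq, reduceCtorEq, false_or] at h
  obtain ⟨hmem, h1, h2, h3⟩ := h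
  obtain rfl := h3.resolve_right fun h3 => h' ⟨hmem, h1, h2, h3⟩
  rw [if_pos (by simp [Finset.insert_subset_iff, h1, h2])]
  simp

theorem card_loadedPairs_insert_inr_le (s : List (Fin k ⊕ Fin k × Fin k))
    (z : (Fin k × Fin k) × (Fin n × Fin n)) (X : Finset (Candidate n k)) :
    ((loadedPairs s (insert (Sum.inr z) X) \ loadedPairs s X).card : ℝ) ≤
      if {Sum.inl (z.1.1, z.2.1), Sum.inl (z.1.2, z.2.2)} ⊆ X then 1 else 0 := by
  refine (Nat.cast_le.2 (Finset.card_le_card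
    (loadedPairs_insert_inr_sdiff_subset s z X))).trans (le_of_eq ?_)
  split_ifs <;> simp

/-- An incident pair loaded when `i` is about to be loaded avoids the embedded copy of `H`. -/
theorem incidentCandidates_subset_of_subset_union {s : List (Fin k ⊕ Fin k × Fin k)}
    (hnd : s.Nodup)
    (hs : ∀ (t : ℕ) (i j : Fin k), s[t]? = some (Sum.inr (i, j)) →
      Sum.inl i ∈ s.take t ∧ Sum.inl j ∈ s.take t)
    {a : Fin k → Fin n} {t : ℕ} (ht : t < s.length) {i : Fin k} (hi : s[t] = Sum.inl i)
    {Y : Finset (Candidate n k)} (hY : Disjoint Y (placed (Candidate.ofMap a) s s.length))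
    {z : (Fin k × Fin n) ⊕ (Fin k × Fin n)} (hz : incident s i z)
    (h : incidentCandidates i (a i) z ⊆ Y ∪ placed (Candidate.ofMap a) s t) :
    incidentCandidates i (a i) z ⊆ Y := by
  have hnot : Sum.inl i ∉ s.take t := fun hmem => by
    obtain ⟨t', ht', h'⟩ := List.mem_take_iff_getElem.1 hmem
    have := (List.Nodup.getElem_inj_iff hnd).1 (h'.trans hi.symm)
    omega
  have hpair : ∀ e : Fin k × Fin k, e.1 = i ∨ e.2 = i → Sum.inr e ∉ s.take t := by
    rintro ⟨j, l⟩ hjl hmem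
    obtain ⟨t', ht', h'⟩ := List.mem_take_iff_getElem.1 hmem
    have hlt : t' < s.length := by omega
    obtain ⟨h1, h2⟩ := hs t' j l (by rw [List.getElem?_eq_getElem hlt, h'])
    have hsub : s.take t' ⊆ s.take t := List.take_subset_take_left s (by omega)
    rcases hjl with rfl | rfl
    exacts [hnot (hsub h1), hnot (hsub h2)]
  have hend : ((incidentPair i (a i) z).1.1 = i ∨ (incidentPair i (a i) z).1.2 = i) := by
    rcases z with z | z
    exacts [Or.inl rfl, Or.inr rfl]
  simp only [incidentCandidates, Finset.insert_subset_iff, Finset.singleton_subset_iff,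
    Finset.mem_union] at h ⊢
  have h2 : Sum.inr (incidentPair i (a i) z) ∈ Y := h.2.resolve_right fun hp => by
    obtain ⟨e, he, heq⟩ := mem_placed.1 hp
    have hk := congrArg Candidate.kind heq
    rw [Candidate.kind_ofMap] at hk
    subst hk
    exact hpair _ hend he
  refine ⟨h.1.resolve_right fun hp => ?_, h2⟩
  obtain ⟨e, he, heq⟩ := mem_placed.1 hp
  have hk := congrArg Candidate.kind heq
  rw [Candidate.kind_ofMap] at hk
  subst hk
  refine Finset.disjoint_left.1 hY h2 (mem_placed.2 ⟨Sum.inr (incidentPair i (a i) z).1, ?_, ?_⟩)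
  · rw [List.take_length]
    rcases z with z | z
    exacts [hz, hz]
  · rcases z with ⟨j, u⟩ | ⟨j, u⟩ <;>
    · simp [Candidate.ofMap, Candidate.kind] at heq
      simp [Candidate.ofMap, incidentPair, heq]

/-- The inclusion probability of a candidate of the given kind: `r_u / n` for a vertex and half of
`d_{uv} / max{r_u, r_v}` for an edge. -/
noncomputable def loadProb (n k : ℕ) (H : SimpleGraph (Fin k)) (r : Fin k → ℕ)
    (d : Fin k → Fin k → ℕ) : Fin k ⊕ Fin k × Fin k → ℝ
  | Sum.inl u => (r u : ℝ) / n
  | Sum.inr (u, v) => if H.Adj u v then (d u v : ℝ) / (2 * max (r u : ℝ) (r v)) else 1 / 2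

theorem loadProb_pos {H : SimpleGraph (Fin k)} {r : Fin k → ℕ} {d : Fin k → Fin k → ℕ}
    (h : Admissible n k H r d) : ∀ e, 0 < loadProb n k H r d e
  | Sum.inl u => by
    have h1 := h.2.1 u
    exact div_pos (Nat.cast_pos.2 (by omega)) (Nat.cast_pos.2 (by omega))
  | Sum.inr (u, v) => by
    rw [loadProb]
    split_ifs with huv
    · have h1 := (h.2.1 u).1
      have h2 := (h.2.2.1 u v huv).1
      have : (0 : ℝ) < max (r u : ℝ) (r v) := lt_max_of_lt_left (Nat.cast_pos.2 h1)
      exact div_pos (Nat.cast_pos.2 h2) (by positivity)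
    · norm_num

theorem loadProb_le_half {H : SimpleGraph (Fin k)} {r : Fin k → ℕ} {d : Fin k → Fin k → ℕ}
    (h : Admissible n k H r d) : ∀ e, loadProb n k H r d e ≤ 1 / 2
  | Sum.inl u => by
    have h1 := h.2.1 u
    have hn : (0 : ℝ) < n := Nat.cast_pos.2 (by omega)
    have h2 : (4 : ℝ) * r u ≤ n := by exact_mod_cast h1.2
    rw [loadProb, div_le_iff₀ hn]
    linarith
  | Sum.inr (u, v) => by
    rw [loadProb]
    split_ifs with huv
    · have h1 := (h.2.1 u).1
      have h2 : (d u v : ℝ) ≤ max (r u : ℝ) (r v) := by exact_mod_cast (h.2.2.1 u v huv).2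
      have : (0 : ℝ) < max (r u : ℝ) (r v) := lt_max_of_lt_left (Nat.cast_pos.2 h1)
      rw [div_le_div_iff₀ (by positivity) two_pos]
      linarith
    · exact le_rfl

theorem sqrt_inv_prod_loadProb_le {H : SimpleGraph (Fin k)} {r : Fin k → ℕ}
    {d : Fin k → Fin k → ℕ} (h : Admissible n k H r d) (l : List (Fin k ⊕ Fin k × Fin k))
    (hl : ∀ i j : Fin k, Sum.inr (i, j) ∈ l → H.Adj i j) :
    √(l.map (loadProb n k H r d)).prod⁻¹ ≤
      2 ^ l.length * (l.map (entryFactor n k r d)).prod := by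
  induction l with
  | nil => simp
  | cons e l ih =>
    have hstep : √(loadProb n k H r d e)⁻¹ ≤ 2 * entryFactor n k r d e := by
      rcases e with u | ⟨u, v⟩
      · rw [loadProb, entryFactor, inv_div]
        linarith [Real.sqrt_nonneg ((n : ℝ) / r u)]
      · have h1 := (h.2.1 u).1
        have : (0 : ℝ) < max (r u : ℝ) (r v) := lt_max_of_lt_left (Nat.cast_pos.2 h1)
        rw [loadProb, entryFactor, if_pos (hl u v List.mem_cons_self), inv_div, mul_div_assoc,
          Real.sqrt_mul two_pos.le]
        refine mul_le_mul_of_nonneg_right ?_ (Real.sqrt_nonneg _)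
        rw [Real.sqrt_le_left two_pos.le]
        norm_num
    have hl' := ih fun i j hij => hl i j (List.mem_cons_of_mem e hij)
    rw [List.map_cons, List.prod_cons, List.map_cons, List.prod_cons, mul_inv,
      Real.sqrt_mul (inv_nonneg.2 (loadProb_pos h e).le), List.length_cons]
    calc _ ≤ (2 * entryFactor n k r d e) *
          (2 ^ l.length * (l.map (entryFactor n k r d)).prod) :=
          mul_le_mul hstep hl' (Real.sqrt_nonneg _) ((Real.sqrt_nonneg _).trans hstep)
      _ = _ := by ring

/-- The expected number of pairs queried when loading the vertex `i`, up to a constant. -/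
noncomputable def vertexLength (H : SimpleGraph (Fin k)) (r : Fin k → ℕ)
    (d : Fin k → Fin k → ℕ) (i : Fin k) : ℝ :=
  ∑ j, if H.Adj i j then (r j : ℝ) * d i j / max (r i : ℝ) (r j) else 0

theorem vertexLength_eq {H : SimpleGraph (Fin k)} [DecidableRel H.Adj] {r : Fin k → ℕ}
    {d : Fin k → Fin k → ℕ} (h : Admissible n k H r d) (i : Fin k) :
    vertexLength H r d i =
      (∑ j ∈ Finset.univ.filter (fun j : Fin k => H.Adj i j ∧ r i ≤ r j), (d i j : ℝ)) +
         (∑ j ∈ Finset.univ.filter (fun j : Fin k => H.Adj i j ∧ r j < r i),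
            (r j : ℝ) * d i j / r i) := by
  rw [vertexLength, Finset.sum_filter, Finset.sum_filter, ← Finset.sum_add_distrib]
  refine Finset.sum_congr rfl fun j _ => ?_
  by_cases hij : H.Adj i j
  · have hj : (r j : ℝ) ≠ 0 := Nat.cast_ne_zero.2 (Nat.one_le_iff_ne_zero.1 (h.2.1 j).1)
    rcases le_or_gt (r i) (r j) with hr | hr
    · rw [if_pos hij, if_pos ⟨hij, hr⟩, if_neg fun h => hr.not_gt h.2,
        max_eq_right (Nat.cast_le.2 hr), mul_div_cancel_left₀ _ hj, add_zero]
    · rw [if_pos hij, if_neg fun h => h.2.not_gt hr, if_pos ⟨hij, hr⟩,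
        max_eq_left (Nat.cast_le.2 hr.le), zero_add]
  · simp [hij]

theorem vertexLength_pos {H : SimpleGraph (Fin k)} {r : Fin k → ℕ}
    {d : Fin k → Fin k → ℕ} (h : Admissible n k H r d) (i : Fin k) :
    0 < vertexLength H r d i := by
  obtain ⟨j, hij, -⟩ := h.2.2.2 i
  have hr : (0 : ℝ) < r j := Nat.cast_pos.2 (h.2.1 j).1
  have hd : (0 : ℝ) < d i j := Nat.cast_pos.2 (h.2.2.1 i j hij).1
  have hm : (0 : ℝ) < max (r i : ℝ) (r j) := lt_max_of_lt_right hr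
  refine Finset.sum_pos' (fun j _ => ?_) ⟨j, Finset.mem_univ _, ?_⟩
  · split_ifs <;> positivity
  · rw [if_pos hij]
    positivity

theorem sum_incident_le {H : SimpleGraph (Fin k)} {r : Fin k → ℕ}
    {d : Fin k → Fin k → ℕ} (h : Admissible n k H r d) {s : List (Fin k ⊕ Fin k × Fin k)}
    (hs : ∀ i j : Fin k, Sum.inr (i, j) ∈ s → H.Adj i j) (i : Fin k) (v : Fin n) :
    (∑ z, if incident s i z then
      ∏ a ∈ incidentCandidates i v z, (loadProb n k H r d ∘ Candidate.kind) a else 0) ≤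
      vertexLength H r d i := by
  have hn : (n : ℝ) ≠ 0 := Nat.cast_ne_zero.2 (by have := h.2.1 i; omega)
  have hprod : ∀ z, ∏ a ∈ incidentCandidates i v z, (loadProb n k H r d ∘ Candidate.kind) a =
      (r (z.elim id id).1 : ℝ) / n * loadProb n k H r d (Sum.inr (incidentPair i v z).1) :=
    fun z => by
      rw [incidentCandidates, Finset.prod_pair (by simp)]
      rfl
  simp only [hprod]
  rw [Fintype.sum_sum_type, Fintype.sum_prod_type, Fintype.sum_prod_type,
    ← Finset.sum_add_distrib, vertexLength]
  refine Finset.sum_le_sum fun j _ => ?_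
  simp only [incident, incidentPair, Sum.elim_inl, Sum.elim_inr, id, loadProb,
    H.adj_comm j i, max_comm (r j : ℝ) (r i), h.1 j i]
  by_cases hij : H.Adj i j
  · have hm : (0 : ℝ) < max (r i : ℝ) (r j) :=
      lt_max_of_lt_left (Nat.cast_pos.2 (h.2.1 i).1)
    have key : (n : ℝ) * ((r j : ℝ) / n * (d i j / (2 * max (r i : ℝ) (r j)))) =
        r j * d i j / max (r i : ℝ) (r j) / 2 := by
      field_simp
    have hpos : 0 ≤ r j * d i j / max (r i : ℝ) (r j) := by positivity
    by_cases h1 : Sum.inr (i, j) ∈ s <;> by_cases h2 : Sum.inr (j, i) ∈ s <;>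
      simp only [h1, h2, hij, if_true, if_false, Finset.sum_const, Finset.card_univ,
        Fintype.card_fin, nsmul_eq_mul, mul_zero, key] <;> linarith
  · have h1 : Sum.inr (i, j) ∉ s := fun h => hij (hs i j h)
    have h2 : Sum.inr (j, i) ∉ s := fun h => hij (hs j i h).symm
    simp [h1, h2, hij]

theorem sum_loadedPairs_le {H : SimpleGraph (Fin k)} [DecidableRel H.Adj] {r : Fin k → ℕ}
    {d : Fin k → Fin k → ℕ} (h : Admissible n k H r d) {s : List (Fin k ⊕ Fin k × Fin k)}
    (hs : ∀ i j : Fin k, Sum.inr (i, j) ∈ s → H.Adj i j) (S : Finset (Candidate n k)) :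
    ∑ X ∈ S.powerset, bernoulliWeight (loadProb n k H r d ∘ Candidate.kind) S X *
      ((loadedPairs s X).card : ℝ) ≤ setupCost k H r d := by
  refine (sum_bernoulliWeight_mul_le (fun a => loadProb_pos h _)
    (fun a => (loadProb_le_half h _).trans_lt (by norm_num)) S
    (fun z : (Fin k × Fin k) × (Fin n × Fin n) => Sum.inr z.1 ∈ s)
    (fun z => {Sum.inl (z.1.1, z.2.1), Sum.inl (z.1.2, z.2.2), Sum.inr z})
    fun X _ => le_of_eq ?_).trans ?_
  · rw [Finset.sum_boole, loadedPairs]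
    simp [Finset.insert_subset_iff]
  · rw [setupCost, Finset.sum_filter, Finset.sum_div, Fintype.sum_prod_type]
    refine Finset.sum_le_sum fun e _ => ?_
    by_cases he : Sum.inr e ∈ s
    · obtain ⟨i, j⟩ := e
      have hij := hs i j he
      have hprod : ∀ w : Fin n × Fin n,
          ∏ a ∈ ({Sum.inl (i, w.1), Sum.inl (j, w.2), Sum.inr ((i, j), w)} :
            Finset (Candidate n k)), (loadProb n k H r d ∘ Candidate.kind) a =
          (r i : ℝ) / n * (r j / n * (d i j / (2 * max (r i : ℝ) (r j)))) := fun w => by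
        rw [Finset.prod_insert (by simp [hij.ne]), Finset.prod_pair (by simp)]
        simp [loadProb, Candidate.kind, hij]
      have hn : (n : ℝ) ≠ 0 := Nat.cast_ne_zero.2 (by have := h.2.1 i; omega)
      have hm : (0 : ℝ) < max (r i : ℝ) (r j) :=
        lt_max_of_lt_left (Nat.cast_pos.2 (h.2.1 i).1)
      refine le_of_eq ((Finset.sum_congr rfl fun w _ => (if_pos he).trans (hprod w)).trans ?_)
      simp only [hij, if_true, Finset.sum_const, Finset.card_univ, Fintype.card_prod,
        Fintype.card_fin, nsmul_eq_mul, Nat.cast_mul]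
      have hmm := min_mul_max (r i : ℝ) (r j)
      field_simp
      linear_combination (-(d i j : ℝ)) * hmm
    · simp only [he, if_false, Finset.sum_const_zero]
      split_ifs <;> positivity

/-- The bound on the total expected length over all insertions at a stage. -/
noncomputable def stageNegative (n : ℕ) (H : SimpleGraph (Fin k)) (r : Fin k → ℕ)
    (d : Fin k → Fin k → ℕ) : Option (Fin k ⊕ Fin k × Fin k) → ℝ
  | some (Sum.inl i) => n * vertexLength H r d i
  | some (Sum.inr (i, j)) => r i * r j
  | none => 1

/-- The bound on the expected length of the insertion used by the flow at a stage. -/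
noncomputable def stagePositive (H : SimpleGraph (Fin k)) (r : Fin k → ℕ)
    (d : Fin k → Fin k → ℕ) : Option (Fin k ⊕ Fin k × Fin k) → ℝ
  | some (Sum.inl i) => vertexLength H r d i
  | some (Sum.inr _) => 1
  | none => 1

theorem stageNegative_pos {H : SimpleGraph (Fin k)} {r : Fin k → ℕ}
    {d : Fin k → Fin k → ℕ} (h : Admissible n k H r d) : ∀ o, 0 < stageNegative n H r d o
  | some (Sum.inl i) => mul_pos (Nat.cast_pos.2 (by have := h.2.1 i; omega)) (vertexLength_pos h i)
  | some (Sum.inr (i, j)) => mul_pos (Nat.cast_pos.2 (h.2.1 i).1) (Nat.cast_pos.2 (h.2.1 j).1)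
  | none => one_pos

theorem stagePositive_pos {H : SimpleGraph (Fin k)} {r : Fin k → ℕ}
    {d : Fin k → Fin k → ℕ} (h : Admissible n k H r d) : ∀ o, 0 < stagePositive H r d o
  | some (Sum.inl i) => vertexLength_pos h i
  | some (Sum.inr _) => one_pos
  | none => one_pos

theorem sum_stage_le_stageNegative {H : SimpleGraph (Fin k)} {r : Fin k → ℕ}
    {d : Fin k → Fin k → ℕ} (h : Admissible n k H r d) {s : List (Fin k ⊕ Fin k × Fin k)}
    (hs : ∀ i j : Fin k, Sum.inr (i, j) ∈ s → H.Adj i j) (e : Fin k ⊕ Fin k × Fin k)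
    (he : e ∈ s) :
    ∑ X : Finset (Candidate n k),
      bernoulliWeight (loadProb n k H r d ∘ Candidate.kind) Finset.univ X *
        ∑ a ∈ Finset.univ.filter (fun a : Candidate n k => e = a.kind),
          ((loadedPairs s (insert a X) \ loadedPairs s X).card : ℝ) ≤
      stageNegative n H r d (some e) := by
  have hπ0 : ∀ a : Candidate n k, 0 < (loadProb n k H r d ∘ Candidate.kind) a :=
    fun a => loadProb_pos h _
  have hπ1 : ∀ a : Candidate n k, (loadProb n k H r d ∘ Candidate.kind) a < 1 :=
    fun a => (loadProb_le_half h _).trans_lt (by norm_num)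
  rcases e with i | ⟨i, j⟩
  · simp only [sum_kind_inl, Finset.mul_sum]
    rw [Finset.sum_comm, stageNegative]
    calc _ ≤ ∑ _v : Fin n, vertexLength H r d i := Finset.sum_le_sum fun v _ => by
          rw [← Finset.powerset_univ]
          exact (sum_bernoulliWeight_mul_le hπ0 hπ1 _ _ _ fun X _ =>
            card_loadedPairs_insert_inl_le (fun i j hij => (hs i j hij).ne) i v X).trans
              (sum_incident_le h hs i v)
      _ = _ := by simp
  · simp only [sum_kind_inr]
    rw [← Finset.powerset_univ, stageNegative]
    refine (sum_bernoulliWeight_mul_le hπ0 hπ1 _ (fun _ => True)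
      (fun w : Fin n × Fin n => {Sum.inl (i, w.1), Sum.inl (j, w.2)}) fun X _ =>
        Finset.sum_le_sum fun w _ => ?_).trans (le_of_eq ?_)
    · simpa only [true_and] using card_loadedPairs_insert_inr_le s ((i, j), w) X
    · have hij := hs i j he
      have hn : (n : ℝ) ≠ 0 := Nat.cast_ne_zero.2 (by have := h.2.1 i; omega)
      have hprod : ∀ w : Fin n × Fin n,
          ∏ a ∈ ({Sum.inl (i, w.1), Sum.inl (j, w.2)} : Finset (Candidate n k)),
            (loadProb n k H r d ∘ Candidate.kind) a = (r i : ℝ) / n * (r j / n) := fun w => by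
        rw [Finset.prod_pair (by simp [hij.ne])]
        rfl
      simp only [if_true, hprod, Finset.sum_const, Finset.card_univ, Fintype.card_prod,
        Fintype.card_fin, nsmul_eq_mul, Nat.cast_mul]
      field_simp

theorem sum_stage_le_stagePositive {H : SimpleGraph (Fin k)} [DecidableRel H.Adj]
    {r : Fin k → ℕ} {d : Fin k → Fin k → ℕ} (h : Admissible n k H r d)
    {s : List (Fin k ⊕ Fin k × Fin k)} (hs : IsSchedule k H s) (a : Fin k → Fin n)
    {t : ℕ} (ht : t < s.length) :
    ∑ Y ∈ (placed (Candidate.ofMap a) s s.length)ᶜ.powerset,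
      bernoulliWeight (loadProb n k H r d ∘ Candidate.kind)
        (placed (Candidate.ofMap a) s s.length)ᶜ Y *
        ((loadedPairs s (insert (Candidate.ofMap a s[t]) (Y ∪ placed (Candidate.ofMap a) s t)) \
          loadedPairs s (Y ∪ placed (Candidate.ofMap a) s t)).card : ℝ) ≤
      stagePositive H r d (some s[t]) := by
  obtain ⟨-, hnd, hadj, -, -, hord⟩ := hs
  have hπ0 : ∀ a : Candidate n k, 0 < (loadProb n k H r d ∘ Candidate.kind) a :=
    fun a => loadProb_pos h _
  have hπ1 : ∀ a : Candidate n k, (loadProb n k H r d ∘ Candidate.kind) a < 1 :=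
    fun a => (loadProb_le_half h _).trans_lt (by norm_num)
  rcases he : s[t] with i | e
  · rw [stagePositive]
    refine (sum_bernoulliWeight_mul_le hπ0 hπ1 _ _ _ fun Y hY => ?_).trans
      (sum_incident_le h hadj i (a i))
    refine (card_loadedPairs_insert_inl_le (fun i j hij => (hadj i j hij).ne) i (a i) _).trans
      (Finset.sum_le_sum fun z _ => ?_)
    have hdisj : Disjoint Y (placed (Candidate.ofMap a) s s.length) :=
      Finset.disjoint_of_subset_left hY disjoint_compl_left
    by_cases hz : incident s i z ∧ incidentCandidates i (a i) z ⊆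
        Y ∪ placed (Candidate.ofMap a) s t
    · rw [if_pos hz, if_pos ⟨hz.1, incidentCandidates_subset_of_subset_union hnd hord ht he hdisj
        hz.1 hz.2⟩]
    · rw [if_neg hz]
      split_ifs <;> norm_num
  · rw [stagePositive, ← sum_bernoulliWeight (loadProb n k H r d ∘ Candidate.kind)
      (placed (Candidate.ofMap a) s s.length)ᶜ]
    refine Finset.sum_le_sum fun Y _ => mul_le_of_le_one_right
      (bernoulliWeight_pos hπ0 hπ1 _ _).le ?_
    refine (card_loadedPairs_insert_inr_le s _ _).trans ?_
    split_ifs <;> norm_num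

theorem sqrt_stage_le_stageCost {H : SimpleGraph (Fin k)} [DecidableRel H.Adj]
    {r : Fin k → ℕ} {d : Fin k → Fin k → ℕ} (h : Admissible n k H r d)
    {s : List (Fin k ⊕ Fin k × Fin k)}
    (hs : ∀ i j : Fin k, Sum.inr (i, j) ∈ s → H.Adj i j) {t : ℕ} (ht : t < s.length) :
    √(stageNegative n H r d s[t]? * stagePositive H r d s[t]? /
      ((s.take t).map (loadProb n k H r d)).prod) ≤
      2 ^ s.length * stageCost n k H r d s t := by
  have hQ : √((s.take t).map (loadProb n k H r d)).prod⁻¹ ≤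
      2 ^ s.length * prefactor n k r d s t := by
    refine (sqrt_inv_prod_loadProb_le h (s.take t)
      fun i j hij => hs i j (List.mem_of_mem_take hij)).trans ?_
    refine mul_le_mul_of_nonneg_right (pow_le_pow_right₀ one_le_two (by simp)) ?_
    refine List.prod_nonneg fun x hx => ?_
    obtain ⟨e, _, rfl⟩ := List.mem_map.1 hx
    rcases e with u | ⟨u, v⟩ <;> exact Real.sqrt_nonneg _
  have hP : 0 ≤ prefactor n k r d s t :=
    nonneg_of_mul_nonneg_right ((Real.sqrt_nonneg _).trans hQ) (by positivity)
  rw [div_eq_mul_inv, Real.sqrt_mul (mul_pos (stageNegative_pos h _) (stagePositive_pos h _)).le,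
    stageCost, List.getElem?_eq_getElem ht]
  rcases s[t] with i | ⟨i, j⟩
  · have hL := (vertexLength_pos h i).le
    rw [stageNegative, stagePositive, mul_assoc, Real.sqrt_mul (Nat.cast_nonneg n),
      Real.sqrt_mul_self hL]
    simp only [← vertexLength_eq h i]
    calc _ ≤ √(n : ℝ) * vertexLength H r d i * (2 ^ s.length * prefactor n k r d s t) :=
          mul_le_mul_of_nonneg_left hQ (mul_nonneg (Real.sqrt_nonneg _) hL)
      _ = _ := by ring
  · rw [stageNegative, stagePositive, mul_one]
    refine (mul_le_mul_of_nonneg_left hQ (Real.sqrt_nonneg _)).trans ?_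
    have hmax : √((r i : ℝ) * r j) ≤ max (r i : ℝ) (r j) := by
      refine Real.sqrt_le_iff.2 ⟨le_max_of_le_left (Nat.cast_nonneg _), ?_⟩
      rw [sq]
      exact mul_le_mul (le_max_left _ _) (le_max_right _ _) (Nat.cast_nonneg _)
        (le_max_of_le_left (Nat.cast_nonneg _))
    have hP' : 0 ≤ 2 ^ s.length * prefactor n k r d s t := by positivity
    simp only
    split_ifs
    · calc _ ≤ max (r i : ℝ) (r j) * (2 ^ s.length * prefactor n k r d s t) :=
            mul_le_mul_of_nonneg_right hmax hP'
        _ = _ := by ring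
    · exact le_of_eq (by ring)

theorem exists_certificate {H : SimpleGraph (Fin k)} [DecidableRel H.Adj]
    {s : List (Fin k ⊕ Fin k × Fin k)} (hs : IsSchedule k H s)
    {y : {e : Sym2 (Fin n) // ¬ e.IsDiag} → Bool} (a : Fin k ↪ Fin n)
    (ha : ∀ i j : Fin k, H.Adj i j →
      ∀ e : {e : Sym2 (Fin n) // ¬ e.IsDiag}, e.1 = s(a i, a j) → y e = true)
    {X : Finset (Candidate n k)} (hX : ∀ e ∈ s, Candidate.ofMap a e ∈ X) :
    ∃ C : Finset {e : Sym2 (Fin n) // ¬ e.IsDiag}, C ⊆ loadedLabel s X ∧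
      ∀ z : {e : Sym2 (Fin n) // ¬ e.IsDiag} → Bool, (∀ i ∈ C, z i = y i) →
        ContainsSubgraph n k H z := by
  obtain ⟨-, -, hadj, hcov, -, hord⟩ := hs
  have key : ∀ i j : Fin k, Sum.inr (i, j) ∈ s → ((i, j), (a i, a j)) ∈ loadedPairs s X := by
    intro i j hij
    obtain ⟨t, ht, h⟩ := List.getElem_of_mem hij
    obtain ⟨h1, h2⟩ := hord t i j (by rw [List.getElem?_eq_getElem ht, h])
    exact mem_loadedPairs.2 ⟨hij, hX _ (List.mem_of_mem_take h1), hX _ (List.mem_of_mem_take h2),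
      hX _ hij⟩
  refine ⟨_, Finset.Subset.refl _, fun z hz => ⟨a, fun i j hij e he => ?_⟩⟩
  rw [hz e, ha i j hij e he]
  rcases hcov i j hij with h | h
  · exact mem_loadedLabel.2 ⟨_, key i j h, he⟩
  · exact mem_loadedLabel.2 ⟨_, key j i h, he.trans Sym2.eq_swap⟩

theorem exists_learningGraph_complexity_le_sum_stageCost {H : SimpleGraph (Fin k)}
    [DecidableRel H.Adj] {r : Fin k → ℕ} {d : Fin k → Fin k → ℕ} (h : Admissible n k H r d)
    {s : List (Fin k ⊕ Fin k × Fin k)} (hs : IsSchedule k H s) :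
    ∃ (V : Type) (G : LearningGraphFor (ContainsSubgraph n k H) V), G.complexity ≤
      2 ^ s.length * (setupCost k H r d + ∑ t ∈ Finset.range s.length,
        2 ^ s.length * stageCost n k H r d s t) := by
  have hadj := hs.2.2.1
  choose a ha using fun y : {y // ContainsSubgraph n k H y} => y.2
  obtain ⟨V, G, hG⟩ := exists_learningGraph_complexity_le (f := ContainsSubgraph n k H) hs.2.1
    (kind := Candidate.kind) (loadProb_pos h) (loadProb_le_half h) (loadedLabel_mono s)
    (σ := fun y => Candidate.ofMap (a y)) (fun y => Candidate.kind_ofMap (a y))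
    (fun y X hX => exists_certificate hs (a y) (ha y) hX)
    (D := setupCost k H r d) (fun S => le_trans (Finset.sum_le_sum fun X _ =>
      mul_le_mul_of_nonneg_left (Nat.cast_le.2 (card_loadedLabel_le s X))
        (bernoulliWeight_pos (fun _ => loadProb_pos h _)
          (fun _ => (loadProb_le_half h _).trans_lt (by norm_num)) _ _).le)
      (sum_loadedPairs_le h hadj S))
    (U := fun t => stageNegative n H r d s[t]?) (W := fun t => stagePositive H r d s[t]?)
    (fun t => stageNegative_pos h _) (fun t => stagePositive_pos h _)
    (fun t ht => by
      simp only [List.getElem?_eq_getElem ht]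
      refine le_trans (Finset.sum_le_sum fun X _ => mul_le_mul_of_nonneg_left
        (Finset.sum_le_sum fun b _ => Nat.cast_le.2 (card_loadedLabel_sdiff_le s X (insert b X)))
        (bernoulliWeight_pos (fun _ => loadProb_pos h _)
          (fun _ => (loadProb_le_half h _).trans_lt (by norm_num)) _ _).le)
        ((le_of_eq ?_).trans (sum_stage_le_stageNegative h hadj s[t] (List.getElem_mem ht)))
      congr!)
    (fun t ht y => by
      simp only [List.getElem?_eq_getElem ht]
      refine le_trans (Finset.sum_le_sum fun X _ => mul_le_mul_of_nonneg_left
        (Nat.cast_le.2 (card_loadedLabel_sdiff_le s _ _))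
        (bernoulliWeight_pos (fun _ => loadProb_pos h _)
          (fun _ => (loadProb_le_half h _).trans_lt (by norm_num)) _ _).le)
        (sum_stage_le_stagePositive h hs (a y) ht))
  exact ⟨V, G, hG.trans (mul_le_mul_of_nonneg_left (add_le_add le_rfl
    (Finset.sum_le_sum fun t ht =>
      sqrt_stage_le_stageCost h hadj (Finset.mem_range.1 ht))) (by positivity))⟩

end Subgraph

/-- main theorem: for a fixed `k`-vertex graph `H`, admissible
parameters `r, d` and a loading schedule `s` for `H`, the learning graph
complexity of detecting `H` in an `n`-vertex graph is at most a constant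
(depending only on `H`) times the maximum of the setup cost and of the
vertex-loading and edge-loading stage costs (equivalently: at most `c·B` for every common
upper bound `B` of these quantities). -/
theorem subgraph_learning_graph_complexity (k : ℕ) (H : SimpleGraph (Fin k))
    [DecidableRel H.Adj] :
    ∃ c : ℝ, 0 < c ∧
      ∀ (n : ℕ) (r : Fin k → ℕ) (d : Fin k → Fin k → ℕ)
        (s : List (Fin k ⊕ Fin k × Fin k)),
        Admissible n k H r d → IsSchedule k H s →
        ∃ (V : Type) (G : LearningGraphFor (ContainsSubgraph n k H) V),
          ∀ B : ℝ, setupCost k H r d ≤ B →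
            (∀ t < s.length, stageCost n k H r d s t ≤ B) →
            G.complexity ≤ c * B := by
  refine ⟨2 ^ (k + H.edgeFinset.card) *
    (1 + ((k + H.edgeFinset.card : ℕ) : ℝ) * 2 ^ (k + H.edgeFinset.card)),
    by positivity, fun n r d s h hs => ?_⟩
  obtain ⟨V, G, hG⟩ := exists_learningGraph_complexity_le_sum_stageCost h hs
  refine ⟨V, G, fun B hB hstage => hG.trans ?_⟩
  rw [← hs.1, mul_assoc]
  refine mul_le_mul_of_nonneg_left ?_ (by positivity)
  calc _ ≤ B + ∑ _t ∈ Finset.range s.length, 2 ^ s.length * B :=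
        add_le_add hB (Finset.sum_le_sum fun t ht =>
          mul_le_mul_of_nonneg_left (hstage t (Finset.mem_range.1 ht)) (by positivity))
    _ = _ := by
        rw [Finset.sum_const, Finset.card_range, nsmul_eq_mul]
        ring
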